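/- arXiv:2405.20019 — 2 statements merged into one kernel-verified Lean document; each statement's English description precedes it below -/
import Mathlib

section
/- Let W : ℝ₊² → ℝ be a 1-dimensional 2-parameter Brownian sheet, i.e., a centered continuous Gaussian process with E[W(s)W(t)] = min(s₁,t₁)·min(s₂,t₂). Fix α > 0 and β ≥ 0, and define the process M_t := W(t, αt + β) for t ≥ 0. Then M is a continuous martingale with quadratic variation ⟨M⟩_t = t(αt + β), and hence there exists a standard Brownian motion B such that W(t, αt + β) = B(t(αt + β)) for all t ≥ 0. -/
open MeasureTheory ProbabilityTheory Filter Set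
open scoped ENNReal NNReal

noncomputable section

/-- A `d`-dimensional `N`-parameter Brownian sheet: continuous centered Gaussian process
with covariance `∏ min (s j) (t j)` and independent (orthogonal) coordinates. -/
def IsBrownianSheet {Ω : Type*} [MeasureSpace Ω] (N d : ℕ)
    (W : (Fin N → ℝ) → Ω → (Fin d → ℝ)) : Prop :=
  (∀ ω, Continuous fun t => W t ω) ∧
  (∀ t i, Measurable fun ω => W t ω i) ∧
  (∀ (n : ℕ) (t : Fin n → Fin N → ℝ) (c : Fin n → Fin d → ℝ),
      (∀ k j, 0 ≤ t k j) →
      ∃ v : ℝ≥0,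
        Measure.map (fun ω => ∑ k, ∑ i, c k i * W (t k) ω i) ℙ = gaussianReal 0 v) ∧
  (∀ i s t, (∀ j, 0 ≤ s j) → (∀ j, 0 ≤ t j) →
      ∫ ω, W s ω i * W t ω i ∂ℙ = ∏ j, min (s j) (t j)) ∧
  (∀ i i', i ≠ i' → ∀ s t, (∀ j, 0 ≤ s j) → (∀ j, 0 ≤ t j) →
      ∫ ω, W s ω i * W t ω i' ∂ℙ = 0)

/-- A standard Brownian motion in `ℝ^d` started at `a`. -/
def IsBMFrom {Ω : Type*} [MeasureSpace Ω] (d : ℕ) (a : EuclideanSpace ℝ (Fin d))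
    (B : ℝ → Ω → EuclideanSpace ℝ (Fin d)) : Prop :=
  (∀ ω, B 0 ω = a) ∧
  (∀ ω, Continuous fun t => B t ω) ∧
  (∀ t i, Measurable fun ω => B t ω i) ∧
  (∀ (n : ℕ) (t : Fin n → ℝ) (c : Fin n → Fin d → ℝ), (∀ k, 0 ≤ t k) →
      ∃ v : ℝ≥0,
        Measure.map (fun ω => ∑ k, ∑ i, c k i * (B (t k) ω i - a i)) ℙ = gaussianReal 0 v) ∧
  (∀ i s t, 0 ≤ s → 0 ≤ t → ∫ ω, (B s ω i - a i) * (B t ω i - a i) ∂ℙ = min s t) ∧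
  (∀ i i', i ≠ i' → ∀ s t, 0 ≤ s → 0 ≤ t →
      ∫ ω, (B s ω i - a i) * (B t ω i' - a i') ∂ℙ = 0)

/-- A standard one-dimensional Brownian motion (started at 0). -/
def IsBM1 {Ω : Type*} [MeasureSpace Ω] (B : ℝ → Ω → ℝ) : Prop :=
  (∀ ω, Continuous fun t => B t ω) ∧
  (∀ ω, B 0 ω = 0) ∧
  (∀ t, Measurable (B t)) ∧
  (∀ (n : ℕ) (t : Fin n → ℝ) (c : Fin n → ℝ), (∀ k, 0 ≤ t k) →
      ∃ v : ℝ≥0, Measure.map (fun ω => ∑ k, c k * B (t k) ω) ℙ = gaussianReal 0 v) ∧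
  (∀ s t, 0 ≤ s → 0 ≤ t → ∫ ω, B s ω * B t ω ∂ℙ = min s t)

section PreBrownian

variable {Ω : Type*} {mΩ : MeasurableSpace Ω} {P : Measure Ω} {X : ℝ≥0 → Ω → ℝ}

/-- A real process all of whose finite linear combinations are Gaussian is a Gaussian process. -/
lemma isGaussianProcess_of_forall_linearCombination {T : Type*} {X : T → Ω → ℝ}
    (hX : ∀ t, Measurable (X t))
    (h : ∀ (n : ℕ) (t : Fin n → T) (c : Fin n → ℝ),
      ∃ m v, P.map (fun ω => ∑ k, c k * X (t k) ω) = gaussianReal m v) :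
    IsGaussianProcess X P where
  hasGaussianLaw I := by
    classical
    have hmeas : Measurable fun ω => I.restrict (X · ω) := measurable_pi_lambda _ fun i => hX i
    refine ⟨⟨fun L => ?_⟩⟩
    obtain ⟨m, v, hmv⟩ := h (Fintype.card I) (fun k => ((Fintype.equivFin I).symm k : T))
      (fun k => L (Pi.single ((Fintype.equivFin I).symm k) 1))
    have hL : (L ∘ fun ω => I.restrict (X · ω)) = fun ω => ∑ k,
        L (Pi.single ((Fintype.equivFin I).symm k) 1) * X ((Fintype.equivFin I).symm k) ω := by
      funext ω
      rw [Equiv.sum_comp (Fintype.equivFin I).symm fun i : I => L (Pi.single i 1) * X i ω]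
      have hsingle (i : I) : (Pi.single i 1 : I → ℝ) = fun j => if i = j then 1 else 0 := by
        ext j
        simp [Pi.single_apply, eq_comm]
      simpa [mul_comm, hsingle] using
        (L : (I → ℝ) →ₗ[ℝ] ℝ).pi_apply_eq_sum_univ (I.restrict (X · ω))
    have hmap : (P.map fun ω => I.restrict (X · ω)).map L = gaussianReal m v := by
      rw [Measure.map_map (by fun_prop) hmeas, hL, hmv]
    have hmean : ∫ x, L x ∂(P.map fun ω => I.restrict (X · ω)) = m := by
      rw [← integral_id_gaussianReal (μ := m) (v := v), ← hmap,
        integral_map L.measurable.aemeasurable (by fun_prop)]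
    have hvar : Var[L; P.map fun ω => I.restrict (X · ω)] = v := by
      rw [← variance_id_gaussianReal (μ := m) (v := v), ← hmap,
        variance_map (by fun_prop) L.measurable.aemeasurable, Function.id_comp]
    rw [hmap, hmean, hvar, Real.toNNReal_coe]

/-- A centered Gaussian process with `E[X s * X t] = min s t` is a pre-Brownian motion. -/
lemma isPreBrownianReal_of_forall_linearCombination (hX : ∀ t, Measurable (X t))
    (h : ∀ (n : ℕ) (t : Fin n → ℝ≥0) (c : Fin n → ℝ),
      ∃ v, P.map (fun ω => ∑ k, c k * X (t k) ω) = gaussianReal 0 v)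
    (hcov : ∀ s t, s ≤ t → ∫ ω, X s ω * X t ω ∂P = s) :
    IsPreBrownianReal X P := by
  have hG : IsGaussianProcess X P :=
    isGaussianProcess_of_forall_linearCombination hX fun n t c => ⟨0, h n t c⟩
  have := hG.isProbabilityMeasure
  have hmean t : P[X t] = 0 := by
    obtain ⟨v, hv⟩ := h 1 (fun _ => t) (fun _ => 1)
    have hv : P.map (X t) = gaussianReal 0 v := by simpa using hv
    rw [← integral_id_gaussianReal (μ := 0) (v := v), ← hv,
      integral_map (hX t).aemeasurable (by fun_prop)]
  refine hG.isPreBrownianReal_of_covariance hmean fun s t hst => ?_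
  rw [covariance_eq_sub (hG.hasGaussianLaw_eval s).memLp_two (hG.hasGaussianLaw_eval t).memLp_two,
    hmean, zero_mul, sub_zero]
  exact hcov s t hst

lemma ProbabilityTheory.IsPreBrownianReal.integral_mul_eval (hX : IsPreBrownianReal X P)
    (s t : ℝ≥0) : ∫ ω, X s ω * X t ω ∂P = min s t := by
  have := hX.isGaussianProcess.isProbabilityMeasure
  have h := covariance_eq_sub (hX.isGaussianProcess.hasGaussianLaw_eval s).memLp_two
    (hX.isGaussianProcess.hasGaussianLaw_eval t).memLp_two
  rw [hX.covariance_eval, hX.integral_eval, zero_mul, sub_zero] at h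
  exact h.symm

lemma ProbabilityTheory.IsPreBrownianReal.memLp_two (hX : IsPreBrownianReal X P) (t : ℝ≥0) :
    MemLp (X t) 2 P :=
  (hX.isGaussianProcess.hasGaussianLaw_eval t).memLp_two

/-- The increments of a pre-Brownian motion are independent of the past. -/
lemma ProbabilityTheory.IsPreBrownianReal.indep_sub_natural (hX : IsPreBrownianReal X P)
    (hm : ∀ t, StronglyMeasurable (X t)) {s t : ℝ≥0} (hst : s ≤ t) :
    Indep (MeasurableSpace.comap (X t - X s) inferInstance) (Filtration.natural X hm s) P := by
  have heval : Measurable fun x : ℝ≥0 → ℝ => x (t - s) := measurable_pi_apply _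
  have h := (hX.indepFun_shift s).comp heval measurable_id
  rw [Filtration.natural_eq_comap]
  rw [IndepFun_iff_Indep] at h
  convert h using 2
  · ext ω
    simp [add_tsub_cancel_of_le hst]
  · rfl

/-- A pre-Brownian motion is a martingale in its natural filtration. -/
lemma ProbabilityTheory.IsPreBrownianReal.martingale_natural (hX : IsPreBrownianReal X P)
    (hm : ∀ t, StronglyMeasurable (X t)) : Martingale X (Filtration.natural X hm) P := by
  have := hX.isGaussianProcess.isProbabilityMeasure
  have had := Filtration.stronglyAdapted_natural hm
  refine ⟨had, fun s t hst => ?_⟩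
  have h1 : P[X t - X s | Filtration.natural X hm s] =ᵐ[P] fun _ => P[X t - X s] :=
    condExp_indep_eq ((hm t).sub (hm s)).measurable.comap_le (Filtration.le _ s)
      (comap_measurable _).stronglyMeasurable (hX.indep_sub_natural hm hst)
  have h2 := condExp_add (μ := P) ((hX.integrable_eval t).sub (hX.integrable_eval s))
    (hX.integrable_eval s) (Filtration.natural X hm s)
  rw [sub_add_cancel, condExp_of_stronglyMeasurable _ (had s) (hX.integrable_eval s)] at h2
  filter_upwards [h1, h2] with ω h1 h2
  simp [h2, h1, integral_sub (hX.integrable_eval t) (hX.integrable_eval s), hX.integral_eval]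

/-- The compensated square of a pre-Brownian motion is a martingale in its natural filtration. -/
lemma ProbabilityTheory.IsPreBrownianReal.martingale_sq_sub_natural (hX : IsPreBrownianReal X P)
    (hm : ∀ t, StronglyMeasurable (X t)) :
    Martingale (fun t ω => X t ω ^ 2 - t) (Filtration.natural X hm) P := by
  have := hX.isGaussianProcess.isProbabilityMeasure
  have had := Filtration.stronglyAdapted_natural hm
  refine ⟨fun t => ((had t).pow 2).sub stronglyMeasurable_const, fun s t hst => ?_⟩
  have hD : MemLp (X t - X s) 2 P := (hX.memLp_two t).sub (hX.memLp_two s)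
  have hsq : Integrable ((X t - X s) ^ 2) P := hD.integrable_sq
  have hcross : Integrable (X s * (X t - X s)) P := (hX.memLp_two s).integrable_mul hD
  have hpast : Integrable (fun ω => X s ω ^ 2 - t) P :=
    (hX.memLp_two s).integrable_sq.sub (integrable_const _)
  have h1 : P[(X t - X s) ^ 2 | Filtration.natural X hm s] =ᵐ[P] fun _ => P[(X t - X s) ^ 2] :=
    condExp_indep_eq ((hm t).sub (hm s)).measurable.comap_le (Filtration.le _ s)
      ((comap_measurable _).pow_const 2).stronglyMeasurable (hX.indep_sub_natural hm hst)
  have hvar : ∫ ω, ((X t - X s) ^ 2) ω ∂P = (t - s : ℝ) := by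
    have htt := hX.integral_mul_eval t t
    have hss := hX.integral_mul_eval s s
    have hstt := hX.integral_mul_eval s t
    rw [min_self] at htt hss
    rw [min_eq_left hst] at hstt
    have hi a b : Integrable (fun ω => X a ω * X b ω) P :=
      (hX.memLp_two a).integrable_mul (hX.memLp_two b)
    calc ∫ ω, ((X t - X s) ^ 2) ω ∂P
        = ∫ ω, X t ω * X t ω - 2 * (X s ω * X t ω) + X s ω * X s ω ∂P := by
          congr with ω
          simp only [Pi.pow_apply, Pi.sub_apply]
          ring
      _ = t - s := by
          rw [integral_add (by exact (hi t t).sub ((hi s t).const_mul 2)) (hi s s),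
            integral_sub (hi t t) ((hi s t).const_mul 2), integral_const_mul, htt, hss, hstt]
          ring
  have h2 : P[X t - X s | Filtration.natural X hm s] =ᵐ[P] 0 := by
    filter_upwards [condExp_sub (hX.integrable_eval t) (hX.integrable_eval s)
      (Filtration.natural X hm s), (hX.martingale_natural hm).2 s t hst,
      (hX.martingale_natural hm).2 s s le_rfl] with ω h h' h''
    simp [h, h', h'']
  have h3 := condExp_mul_of_stronglyMeasurable_left (had s) hcross (hD.integrable one_le_two)
  have hdecomp : (fun ω => X t ω ^ 2 - (t : ℝ)) =
      (X t - X s) ^ 2 + (2 : ℝ) • (X s * (X t - X s)) + fun ω => X s ω ^ 2 - (t : ℝ) := by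
    ext ω
    simp only [Pi.add_apply, Pi.pow_apply, Pi.sub_apply, Pi.smul_apply, Pi.mul_apply, smul_eq_mul]
    ring
  have h4 := condExp_add (hsq.add (hcross.smul (2 : ℝ))) hpast (Filtration.natural X hm s)
  have h5 := condExp_add hsq (hcross.smul (2 : ℝ)) (Filtration.natural X hm s)
  have h6 := condExp_smul (μ := P) (2 : ℝ) (X s * (X t - X s)) (Filtration.natural X hm s)
  have hadapted : StronglyMeasurable[Filtration.natural X hm s] fun ω => X s ω ^ 2 - (t : ℝ) :=
    ((had s).pow 2).sub stronglyMeasurable_const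
  rw [← hdecomp, condExp_of_stronglyMeasurable (Filtration.le _ s) hadapted hpast] at h4
  filter_upwards [h1, h2, h3, h4, h5, h6] with ω h1 h2 h3 h4 h5 h6
  rw [h4, Pi.add_apply, h5, Pi.add_apply, h6, Pi.smul_apply, h3, Pi.mul_apply, h2, h1, hvar]
  simp

end PreBrownian

/-- A martingale remains a martingale under a deterministic monotone time change. -/
lemma MeasureTheory.Martingale.comp_monotone {Ω ι κ E : Type*} [Preorder ι] [Preorder κ]
    [NormedAddCommGroup E] [NormedSpace ℝ E] [CompleteSpace E] {mΩ : MeasurableSpace Ω}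
    {P : Measure Ω} {f : ι → Ω → E} {ℱ : Filtration ι mΩ} (hf : Martingale f ℱ P) {φ : κ → ι}
    (hφ : Monotone φ) :
    Martingale (fun t => f (φ t)) ⟨fun t => ℱ (φ t), fun _ _ h => ℱ.mono (hφ h),
      fun t => ℱ.le (φ t)⟩ P :=
  ⟨fun t => hf.1 (φ t), fun s t hst => hf.2 (φ s) (φ t) (hφ hst)⟩

/-- A pre-Brownian motion with continuous paths, made to start at `0` everywhere and extended to
negative times by a constant, is a standard Brownian motion. -/
lemma ProbabilityTheory.IsPreBrownianReal.isBM1 {Ω : Type*} [MeasureSpace Ω] {X : ℝ≥0 → Ω → ℝ}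
    (hX : IsPreBrownianReal X ℙ) (hm : ∀ t, Measurable (X t))
    (hc : ∀ ω, Continuous fun t => X t ω) :
    IsBM1 fun t ω => X t.toNNReal ω - X 0 ω := by
  have hae t : (fun ω => X t ω - X 0 ω) =ᵐ[ℙ] X t := by
    filter_upwards [hX.eval_zero_ae_eq_zero] with ω hω
    simp [hω]
  refine ⟨fun ω => ((hc ω).comp continuous_real_toNNReal).sub continuous_const, fun ω => by simp,
    fun t => (hm _).sub (hm 0), fun n t c _ => ?_, fun s t hs ht => ?_⟩
  · have hG := ((hX.isGaussianProcess.comp_right fun k => (t k).toNNReal).smul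
      c).hasGaussianLaw_fun_sum (I := Finset.univ)
    have hmean : ∫ ω, ∑ k, c k * X (t k).toNNReal ω = 0 := by
      rw [integral_finsetSum _ fun k _ => (hX.integrable_eval _).const_mul _]
      simp [integral_const_mul, hX.integral_eval]
    refine ⟨Var[fun ω => ∑ k, c k * X (t k).toNNReal ω].toNNReal, ?_⟩
    have hsum : (fun ω => ∑ k, c k * (X (t k).toNNReal ω - X 0 ω)) =ᵐ[ℙ]
        fun ω => ∑ k, c k * X (t k).toNNReal ω := by
      filter_upwards [hX.eval_zero_ae_eq_zero] with ω hω
      simp [hω]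
    have h := hG.map_eq_gaussianReal
    simp only [smul_eq_mul, Function.comp_apply] at h
    rw [Measure.map_congr hsum, ← hmean]
    exact h
  · refine (integral_congr_ae ((hae s.toNNReal).mul (hae t.toNNReal))).trans ?_
    refine (hX.integral_mul_eval _ _).trans ?_
    simp [hs, ht]

/-- The increasing bijection `t ↦ t * (α * t + β)` of `ℝ≥0` has a continuous inverse. -/
lemma exists_continuous_inverse_quadratic {α : ℝ≥0} (hα : 0 < α) (β : ℝ≥0) :
    ∃ ψ : ℝ≥0 → ℝ≥0, Continuous ψ ∧ (∀ u, ψ u * (α * ψ u + β) = u) ∧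
      ∀ t, ψ (t * (α * t + β)) = t := by
  have hα' : (0 : ℝ) < α := hα
  refine ⟨fun u => ((-β + √(β ^ 2 + 4 * α * u)) / (2 * α) : ℝ).toNNReal, by fun_prop,
    fun u => ?_, fun t => ?_⟩
  · have hle : (β : ℝ) ≤ √(β ^ 2 + 4 * α * u) :=
      Real.le_sqrt_of_sq_le (le_add_of_nonneg_right (by positivity))
    have hsq : √((β : ℝ) ^ 2 + 4 * α * u) ^ 2 = β ^ 2 + 4 * α * u := Real.sq_sqrt (by positivity)
    rw [← NNReal.coe_inj]
    push_cast
    rw [Real.coe_toNNReal _ (div_nonneg (by linarith) (by positivity))]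
    field_simp
    linear_combination hsq
  · have hsq : √((β : ℝ) ^ 2 + 4 * α * (t * (α * t + β))) = 2 * α * t + β := by
      rw [show (β : ℝ) ^ 2 + 4 * α * (t * (α * t + β)) = (2 * α * t + β) ^ 2 by ring]
      exact Real.sqrt_sq (by positivity)
    push_cast
    rw [hsq, show (-β + (2 * α * t + β)) / (2 * α) = (t : ℝ) by field_simp; ring,
      Real.toNNReal_coe]

/-- the Brownian sheet along a line of positive slope,
`M_t = W(t, αt + β)`, is a continuous martingale with quadratic variation
`⟨M⟩_t = t(αt + β)` (i.e. `M² - t(αt+β)` is a martingale), hence a time-changed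
Brownian motion: `W(t, αt+β) = B(t(αt+β))` for a standard Brownian motion `B`. -/
theorem sheet_along_line_is_time_changed_BM {Ω : Type} [MeasureSpace Ω]
    [IsProbabilityMeasure (ℙ : Measure Ω)]
    (W : (Fin 2 → ℝ) → Ω → (Fin 1 → ℝ)) (hW : IsBrownianSheet 2 1 W)
    (α β : ℝ) (hα : 0 < α) (hβ : 0 ≤ β)
    (M : ℝ≥0 → Ω → ℝ) (hM : ∀ t ω, M t ω = W ![(t : ℝ), α * t + β] ω 0) :
    ∃ ℱ : Filtration ℝ≥0 (inferInstance : MeasurableSpace Ω),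
      (∀ ω, Continuous fun t => M t ω) ∧
      Martingale M ℱ ℙ ∧
      Martingale (fun t ω => (M t ω) ^ 2 - (t : ℝ) * (α * t + β)) ℱ ℙ ∧
      ∃ B : ℝ → Ω → ℝ, IsBM1 B ∧
        ∀ᵐ ω ∂(ℙ : Measure Ω), ∀ t : ℝ≥0, M t ω = B ((t : ℝ) * (α * t + β)) ω := by
  obtain ⟨hcont, hmeas, hgauss, hcov, -⟩ := hW
  lift α to ℝ≥0 using hα.le
  lift β to ℝ≥0 using hβ
  obtain ⟨ψ, hψc, hφψ, hψφ⟩ := exists_continuous_inverse_quadratic (NNReal.coe_pos.1 hα) β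
  have hφ : Monotone fun t : ℝ≥0 => t * (α * t + β) := fun s t hst => by
    dsimp only
    gcongr
  have hψ : Monotone ψ := fun u v huv => by
    by_contra! hlt
    have h := (hφψ v).symm.trans_le (hφ hlt.le) |>.antisymm ((hφψ u).trans_le huv)
    exact hlt.ne ((congrArg ψ h).trans (hψφ (ψ u)))
  have hline (t : ℝ≥0) (j : Fin 2) : 0 ≤ ![(t : ℝ), α * t + β] j := by
    fin_cases j
    · exact t.2
    · exact (α * t + β).2
  have hMcont ω : Continuous fun t => M t ω := by
    simp only [hM]
    refine (continuous_apply 0).comp ((hcont ω).comp (continuous_pi fun j => ?_))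
    fin_cases j
    · exact NNReal.continuous_coe
    · exact (continuous_const.mul NNReal.continuous_coe).add continuous_const
  have hMmeas t : Measurable (M t) := by
    rw [funext (hM t)]
    exact hmeas _ 0
  have hX : IsPreBrownianReal (fun u => M (ψ u)) ℙ := by
    refine isPreBrownianReal_of_forall_linearCombination (fun u => hMmeas _) (fun n t c => ?_)
      fun s t hst => ?_
    · obtain ⟨v, hv⟩ := hgauss n (fun k => ![(ψ (t k) : ℝ), α * ψ (t k) + β]) (fun k _ => c k)
        fun k => hline _
      exact ⟨v, by simpa [hM] using hv⟩
    · simp only [hM]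
      rw [hcov 0 _ _ (hline _) (hline _)]
      have hle : (ψ s : ℝ) ≤ ψ t := hψ hst
      have hle' : (α : ℝ) * ψ s + β ≤ α * ψ t + β := by gcongr
      simp only [Fin.prod_univ_two, Matrix.cons_val_zero, Matrix.cons_val_one, min_eq_left hle,
        min_eq_left hle']
      exact_mod_cast hφψ s
  have hXm u : StronglyMeasurable (M (ψ u)) := (hMmeas _).stronglyMeasurable
  have hmart := (hX.martingale_natural hXm).comp_monotone hφ
  have hsq := (hX.martingale_sq_sub_natural hXm).comp_monotone hφ
  simp only [hψφ, NNReal.coe_mul, NNReal.coe_add] at hmart hsq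
  refine ⟨_, hMcont, hmart, hsq, _, hX.isBM1 (fun u => hMmeas _) fun ω => (hMcont ω).comp hψc, ?_⟩
  filter_upwards [hX.eval_zero_ae_eq_zero] with ω hω t
  have h : ((t : ℝ) * (α * t + β)).toNNReal = t * (α * t + β) := by
    rw [← Real.toNNReal_coe (r := t * (α * t + β))]
    push_cast
    rfl
  simp only [h, hψφ, hω, sub_zero]
end
end

section
/- Let W be an (N,d)-Brownian sheet. There exists a random rank n₀ such that for all n ≥ n₀ and all s, t ∈ ℝ₊^N (within a fixed compact set) with ‖t − s‖_∞ < 2^{−n}, one has |W(t) − W(s)| ≤ n·2^{−n/2}. -/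
open MeasureTheory ProbabilityTheory Filter Set
open scoped ENNReal NNReal

noncomputable section

theorem prod_sub_prod_le_card_mul {ι : Type*} (s : Finset ι) (a b : ι → ℝ) {M δ : ℝ} (hM : 1 ≤ M)
    (hδ : 0 ≤ δ) (hb : ∀ j, 0 ≤ b j) (hba : ∀ j, b j ≤ a j) (haM : ∀ j, a j ≤ M)
    (hab : ∀ j, a j - b j ≤ δ) :
    ∏ j ∈ s, a j - ∏ j ∈ s, b j ≤ s.card * M ^ s.card * δ := by
  classical
  induction s using Finset.induction_on with
  | empty => simp
  | insert x s hx ih =>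
    rw [Finset.prod_insert hx, Finset.prod_insert hx, Finset.card_insert_of_notMem hx]
    have hB0 : 0 ≤ ∏ j ∈ s, b j := Finset.prod_nonneg fun j _ => hb j
    have hBM : ∏ j ∈ s, b j ≤ M ^ s.card :=
      (Finset.prod_le_prod (fun j _ => hb j) fun j _ => (hba j).trans (haM j)).trans_eq (by simp)
    have hAB : 0 ≤ ∏ j ∈ s, a j - ∏ j ∈ s, b j :=
      sub_nonneg.2 (Finset.prod_le_prod (fun j _ => hb j) fun j _ => hba j)
    have hMp : M ^ s.card ≤ M ^ (s.card + 1) := pow_le_pow_right₀ hM (Nat.le_succ _)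
    calc a x * ∏ j ∈ s, a j - b x * ∏ j ∈ s, b j
        = a x * (∏ j ∈ s, a j - ∏ j ∈ s, b j) + (a x - b x) * ∏ j ∈ s, b j := by ring
      _ ≤ M * (s.card * M ^ s.card * δ) + δ * M ^ (s.card + 1) := by
          refine add_le_add (mul_le_mul (haM x) ih hAB (by linarith)) ?_
          exact mul_le_mul (hab x) (hBM.trans hMp) hB0 hδ
      _ = ((s.card + 1 : ℕ) : ℝ) * M ^ (s.card + 1) * δ := by push_cast; ring

theorem measure_le_of_map_eq_gaussianReal {Ω : Type*} [MeasurableSpace Ω] {μ : Measure Ω}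
    [IsProbabilityMeasure μ] {X : Ω → ℝ} (hX : AEMeasurable X μ) {v : ℝ≥0}
    (h : μ.map X = gaussianReal 0 v) {a : ℝ} (ε : ℝ) (ha : 0 ≤ a) :
    μ.real {ω | ε ≤ X ω} ≤ Real.exp (-a * ε + v * a ^ 2 / 2) := by
  have hi : Integrable (fun ω => Real.exp (a * X ω)) μ := by
    have := integrable_exp_mul_gaussianReal (μ := 0) (v := v) a
    rw [← h] at this
    exact this.comp_aemeasurable hX
  have := measure_ge_le_exp_mul_mgf ε ha hi
  rwa [mgf_gaussianReal h, zero_mul, zero_add, ← Real.exp_add] at this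

theorem integral_sq_of_map_eq_gaussianReal {Ω : Type*} [MeasurableSpace Ω] {μ : Measure Ω}
    {X : Ω → ℝ} (hX : AEMeasurable X μ) {v : ℝ≥0}
    (h : μ.map X = gaussianReal 0 v) : ∫ ω, X ω ^ 2 ∂μ = v := by
  have h1 : ∫ x, x ^ 2 ∂(μ.map X) = v := by
    rw [h, ← variance_id_gaussianReal (μ := 0) (v := v), variance_of_integral_eq_zero]
    · simp
    · fun_prop
    · simp
  rw [← h1, integral_map hX (by fun_prop)]

theorem memLp_two_of_map_eq_gaussianReal {Ω : Type*} [MeasurableSpace Ω] {μ : Measure Ω}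
    {X : Ω → ℝ} (hX : AEMeasurable X μ) {v : ℝ≥0}
    (h : μ.map X = gaussianReal 0 v) : MemLp X 2 μ := by
  have := memLp_id_gaussianReal (μ := 0) (v := v) 2
  rw [← h] at this
  exact this.comp_of_map hX

theorem inv_sqrt_two_pow_step {m : ℕ} (hm : 10 ≤ m) :
    (m : ℝ) * (√2)⁻¹ ^ m ≤ 8 * (m * (√2)⁻¹ ^ m) - 8 * ((m + 1 : ℕ) * (√2)⁻¹ ^ (m + 1)) := by
  have hr : (√2)⁻¹ ≤ (3 / 4 : ℝ) := by
    rw [inv_le_comm₀ (by positivity) (by norm_num)]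
    exact Real.le_sqrt_of_sq_le (by norm_num)
  have hm' : (10 : ℝ) ≤ m := by exact_mod_cast hm
  have hp : 0 ≤ (√2)⁻¹ ^ m := by positivity
  rw [pow_succ]
  push_cast
  have : 0 ≤ (√2)⁻¹ ^ m * (7 * m - 8 * (m + 1) * (√2)⁻¹) := by
    apply mul_nonneg hp
    nlinarith
  linarith

/-- The point of the dyadic grid of mesh `2⁻ᵐ` with integer coordinates `k`. -/
def dyadicPoint {N : ℕ} (m : ℕ) (k : Fin N → ℕ) : Fin N → ℝ := fun j => k j / 2 ^ m

/-- The integer coordinates of the lower-left dyadic neighbour of `t` of order `m`. -/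
def dyadicFloor {N : ℕ} (m : ℕ) (t : Fin N → ℝ) : Fin N → ℕ := fun j => ⌊2 ^ m * t j⌋₊

theorem tendsto_dyadicPoint_dyadicFloor {N : ℕ} {t : Fin N → ℝ} (ht : ∀ j, 0 ≤ t j) :
    Tendsto (fun m => dyadicPoint m (dyadicFloor m t)) atTop (nhds t) := by
  refine tendsto_pi_nhds.2 fun j => ?_
  have h2 : Tendsto (fun m : ℕ => (2 : ℝ) ^ m) atTop atTop :=
    tendsto_pow_atTop_atTop_of_one_lt one_lt_two
  refine ((tendsto_nat_floor_mul_div_atTop (ht j)).comp h2).congr fun m => ?_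
  simp [dyadicPoint, dyadicFloor, mul_comm]

theorem dyadicFloor_le {N M : ℕ} {t : Fin N → ℝ} (ht : ∀ j, 0 ≤ t j ∧ t j ≤ M) (m : ℕ) (j : Fin N) :
    dyadicFloor m t j ≤ M * 2 ^ m := by
  refine Nat.floor_le_of_le ?_
  push_cast
  rw [mul_comm]
  exact mul_le_mul_of_nonneg_right (ht j).2 (by positivity)

theorem dyadicFloor_le_succ {N : ℕ} {s t : Fin N → ℝ} {m : ℕ}
    (hs : ∀ j, 0 ≤ s j) (hst : ∀ j, |t j - s j| < (2 ^ m)⁻¹) (j : Fin N) :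
    dyadicFloor m t j ≤ dyadicFloor m s j + 1 := by
  have h := (abs_lt.1 (hst j)).2
  have h2 : (0 : ℝ) < 2 ^ m := by positivity
  have h3 : 2 ^ m * t j < 2 ^ m * s j + 1 := by
    have := mul_lt_mul_of_pos_left h h2
    rw [mul_inv_cancel₀ h2.ne'] at this
    linarith
  rw [dyadicFloor, dyadicFloor, ← Nat.floor_add_one (mul_nonneg h2.le (hs j))]
  exact Nat.floor_le_floor h3.le

theorem dyadicFloor_succ {N : ℕ} {t : Fin N → ℝ} (ht : ∀ j, 0 ≤ t j) (m : ℕ) (j : Fin N) :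
    2 * dyadicFloor m t j ≤ dyadicFloor (m + 1) t j ∧
      dyadicFloor (m + 1) t j ≤ 2 * dyadicFloor m t j + 1 := by
  have h0 : 0 ≤ 2 ^ m * t j := mul_nonneg (by positivity) (ht j)
  have h1 := Nat.floor_le h0
  have h2 := Nat.lt_floor_add_one (2 ^ m * t j)
  unfold dyadicFloor
  constructor
  · apply Nat.le_floor
    push_cast
    rw [pow_succ]
    linarith
  · apply Nat.lt_succ_iff.1
    rw [Nat.floor_lt (by rw [pow_succ]; linarith)]
    push_cast
    rw [pow_succ]
    linarith

theorem dyadicPoint_succ_two_mul {N : ℕ} (m : ℕ) (k : Fin N → ℕ) :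
    dyadicPoint (m + 1) (fun j => 2 * k j) = dyadicPoint m k := by
  ext j
  simp only [dyadicPoint, pow_succ]
  push_cast
  field_simp

theorem abs_sub_le_of_dyadic_increments {N M : ℕ} {f : (Fin N → ℝ) → ℝ} (hf : Continuous f) {c : ℝ}
    (hc : 0 ≤ c) {n : ℕ} (hn : 10 ≤ n)
    (hinc : ∀ m, n ≤ m → ∀ k l : Fin N → ℕ, (∀ j, k j ≤ M * 2 ^ m) → (∀ j, l j ≤ M * 2 ^ m) →
      (∀ j, k j ≤ l j + 1) → (∀ j, l j ≤ k j + 1) →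
      |f (dyadicPoint m k) - f (dyadicPoint m l)| ≤ c * (m * (√2)⁻¹ ^ m))
    {s t : Fin N → ℝ} (hs : ∀ j, 0 ≤ s j ∧ s j ≤ M) (ht : ∀ j, 0 ≤ t j ∧ t j ≤ M)
    (hst : ∀ j, |t j - s j| < (2 ^ n)⁻¹) :
    |f t - f s| ≤ 17 * c * (n * (√2)⁻¹ ^ n) := by
  have chain : ∀ u : Fin N → ℝ, (∀ j, 0 ≤ u j ∧ u j ≤ M) →
      |f u - f (dyadicPoint n (dyadicFloor n u))| ≤ c * (8 * (n * (√2)⁻¹ ^ n)) := by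
    intro u hu
    have step : ∀ m, n ≤ m →
        |f (dyadicPoint m (dyadicFloor m u)) - f (dyadicPoint n (dyadicFloor n u))| ≤
          c * (8 * (n * (√2)⁻¹ ^ n) - 8 * (m * (√2)⁻¹ ^ m)) := by
      intro m hm
      induction m, hm using Nat.le_induction with
      | base => simp
      | succ m hm ih =>
        have h1 := hinc (m + 1) (by omega) (dyadicFloor (m + 1) u)
          (fun j => 2 * dyadicFloor m u j) (dyadicFloor_le hu (m + 1))
          (fun j => by have := dyadicFloor_le hu m j; rw [pow_succ, ← mul_assoc]; omega)
          (fun j => (dyadicFloor_succ (fun j => (hu j).1) m j).2)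
          (fun j => by have := (dyadicFloor_succ (fun j => (hu j).1) m j).1; omega)
        rw [dyadicPoint_succ_two_mul] at h1
        have h2 := mul_le_mul_of_nonneg_left (inv_sqrt_two_pow_step (hn.trans hm)) hc
        have h4 : ((m + 1 : ℕ) : ℝ) * (√2)⁻¹ ^ (m + 1) ≤ m * (√2)⁻¹ ^ m := by
          have := inv_sqrt_two_pow_step (hn.trans hm)
          have : 0 ≤ (m : ℝ) * (√2)⁻¹ ^ m := by positivity
          linarith
        have h5 := mul_le_mul_of_nonneg_left h4 hc
        have h3 := abs_sub_le (f (dyadicPoint (m + 1) (dyadicFloor (m + 1) u)))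
          (f (dyadicPoint m (dyadicFloor m u))) (f (dyadicPoint n (dyadicFloor n u)))
        linarith
    have lim : Tendsto (fun m => |f (dyadicPoint m (dyadicFloor m u)) -
        f (dyadicPoint n (dyadicFloor n u))|) atTop
        (nhds |f u - f (dyadicPoint n (dyadicFloor n u))|) :=
      (((hf.tendsto u).comp (tendsto_dyadicPoint_dyadicFloor fun j => (hu j).1)).sub_const _).abs
    refine le_of_tendsto lim ?_
    filter_upwards [eventually_ge_atTop n] with m hm
    refine (step m hm).trans (mul_le_mul_of_nonneg_left ?_ hc)
    have : 0 ≤ (m : ℝ) * (√2)⁻¹ ^ m := by positivity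
    linarith
  have hmid := hinc n le_rfl (dyadicFloor n t) (dyadicFloor n s) (dyadicFloor_le ht n)
    (dyadicFloor_le hs n)
    (dyadicFloor_le_succ (fun j => (hs j).1) hst)
    (dyadicFloor_le_succ (fun j => (ht j).1)
      fun j => by rw [abs_sub_comm]; exact hst j)
  have ht' := chain t ht
  have hs' := chain s hs
  rw [abs_le] at *
  constructor <;> linarith [ht'.1, ht'.2, hs'.1, hs'.2, hmid.1, hmid.2]

theorem IsBrownianSheet.exists_map_sub_eq_gaussianReal {Ω : Type*} [MeasureSpace Ω] {N d : ℕ}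
    {W : (Fin N → ℝ) → Ω → (Fin d → ℝ)} (hW : IsBrownianSheet N d W) (i : Fin d)
    {s t : Fin N → ℝ} (hs : ∀ j, 0 ≤ s j) (ht : ∀ j, 0 ≤ t j) :
    ∃ v : ℝ≥0, Measure.map (fun ω => W t ω i - W s ω i) ℙ = gaussianReal 0 v ∧
      (v : ℝ) = ∏ j, t j + ∏ j, s j - 2 * ∏ j, min (s j) (t j) := by
  obtain ⟨-, hmeas, hgauss, hcov, -⟩ := hW
  have hmem : ∀ u : Fin N → ℝ, (∀ j, 0 ≤ u j) → MemLp (fun ω => W u ω i) 2 ℙ := by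
    intro u hu
    obtain ⟨v, hv⟩ := hgauss 1 (fun _ => u) (fun _ => Pi.single i 1) (fun _ => hu)
    simp only [Pi.single_apply, ite_mul, one_mul, zero_mul, Finset.sum_ite_eq', Finset.mem_univ,
      if_true, Finset.univ_unique, Finset.sum_singleton] at hv
    exact memLp_two_of_map_eq_gaussianReal (hmeas u i).aemeasurable hv
  obtain ⟨v, hv⟩ := hgauss 2 ![t, s] ![Pi.single i 1, Pi.single i (-1)]
    (by intro k; fin_cases k <;> simpa)
  simp only [Fin.sum_univ_two, Matrix.cons_val_zero, Matrix.cons_val_one, Pi.single_apply, ite_mul,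
    one_mul, zero_mul, neg_mul, Finset.sum_ite_eq', Finset.mem_univ, if_true,
    ← sub_eq_add_neg] at hv
  refine ⟨v, hv, ?_⟩
  rw [← integral_sq_of_map_eq_gaussianReal ((hmeas t i).sub (hmeas s i)).aemeasurable hv]
  have htt : Integrable (fun ω => W t ω i * W t ω i) ℙ := (hmem t ht).integrable_mul (hmem t ht)
  have hss : Integrable (fun ω => W s ω i * W s ω i) ℙ := (hmem s hs).integrable_mul (hmem s hs)
  have hst : Integrable (fun ω => W s ω i * W t ω i) ℙ := (hmem s hs).integrable_mul (hmem t ht)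
  calc ∫ ω, (W t ω i - W s ω i) ^ 2 ∂ℙ
      = ∫ ω, (W t ω i * W t ω i + W s ω i * W s ω i - 2 * (W s ω i * W t ω i)) ∂ℙ := by
        congr with ω; ring
    _ = _ := by
        rw [integral_sub (by exact htt.add hss) (hst.const_mul 2), integral_add htt hss,
          integral_const_mul, hcov i t t ht ht, hcov i s s hs hs, hcov i s t hs ht]
        simp

theorem IsBrownianSheet.measureReal_le_sub_le {Ω : Type*} [MeasureSpace Ω]
    [IsProbabilityMeasure (ℙ : Measure Ω)] {N d : ℕ} {W : (Fin N → ℝ) → Ω → (Fin d → ℝ)}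
    (hW : IsBrownianSheet N d W) (i : Fin d) {M : ℝ} (hM : 1 ≤ M) {s t : Fin N → ℝ}
    (hs : ∀ j, 0 ≤ s j ∧ s j ≤ M) (ht : ∀ j, 0 ≤ t j ∧ t j ≤ M) {δ : ℝ} (hδ : 0 ≤ δ)
    (hst : ∀ j, |t j - s j| ≤ δ) (ε : ℝ) {a : ℝ} (ha : 0 ≤ a) :
    (ℙ : Measure Ω).real {ω | ε ≤ W t ω i - W s ω i} ≤
      Real.exp (-a * ε + N * M ^ N * δ * a ^ 2) := by
  obtain ⟨v, hv, hv'⟩ :=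
    hW.exists_map_sub_eq_gaussianReal i (fun j => (hs j).1) (fun j => (ht j).1)
  have hm : ∀ j, 0 ≤ min (s j) (t j) := fun j => le_min (hs j).1 (ht j).1
  have h1 := prod_sub_prod_le_card_mul Finset.univ t (fun j => min (s j) (t j)) hM hδ hm
    (fun j => min_le_right _ _) (fun j => (ht j).2) (fun j => by
      have := abs_le.1 (hst j)
      rcases min_cases (s j) (t j) with h | h <;> rw [h.1] <;> linarith)
  have h2 := prod_sub_prod_le_card_mul Finset.univ s (fun j => min (s j) (t j)) hM hδ hm
    (fun j => min_le_left _ _) (fun j => (hs j).2) (fun j => by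
      have := abs_le.1 (hst j)
      rcases min_cases (s j) (t j) with h | h <;> rw [h.1] <;> linarith)
  simp only [Finset.card_univ, Fintype.card_fin] at h1 h2
  have hvle : (v : ℝ) ≤ 2 * (N * M ^ N * δ) := by linarith
  refine (measure_le_of_map_eq_gaussianReal
    ((hW.2.1 t i).sub (hW.2.1 s i)).aemeasurable hv ε ha).trans (Real.exp_le_exp.2 ?_)
  have := mul_le_mul_of_nonneg_right hvle (sq_nonneg a)
  linarith

theorem IsBrownianSheet.ae_eventually_dyadic_increments_le {Ω : Type*} [MeasureSpace Ω]
    [IsProbabilityMeasure (ℙ : Measure Ω)] {N d : ℕ} {W : (Fin N → ℝ) → Ω → (Fin d → ℝ)}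
    (hW : IsBrownianSheet N d W) {M : ℕ} (hM : 1 ≤ M) {c : ℝ} (hc : 0 < c) :
    ∀ᵐ ω ∂(ℙ : Measure Ω), ∀ᶠ m in atTop, ∀ i, ∀ k l : Fin N → ℕ, (∀ j, k j ≤ M * 2 ^ m) →
      (∀ j, l j ≤ M * 2 ^ m) → (∀ j, k j ≤ l j + 1) → (∀ j, l j ≤ k j + 1) →
      W (dyadicPoint m k) ω i - W (dyadicPoint m l) ω i ≤ c * (m * (√2)⁻¹ ^ m) := by
  classical
  let G : ℕ → Finset (Fin N → ℕ) := fun m => Fintype.piFinset fun _ => Finset.range (M * 2 ^ m + 1)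
  have hG : ∀ {m k}, k ∈ G m ↔ ∀ j, k j ≤ M * 2 ^ m := by
    intro m k
    simp [G, Fintype.mem_piFinset]
  have hGcard : ∀ m, ((G m).card : ℝ) ≤ (M + 1) ^ N * 2 ^ (N * m) := by
    intro m
    simp only [G, Fintype.card_piFinset, Finset.card_range, Finset.prod_const, Finset.card_univ,
      Fintype.card_fin]
    push_cast
    rw [mul_comm N m, pow_mul, ← mul_pow]
    gcongr
    have : (1 : ℝ) ≤ 2 ^ m := one_le_pow₀ one_le_two
    linarith
  let T : ℕ → Finset (Fin d × (Fin N → ℕ) × (Fin N → ℕ)) := fun m =>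
    (Finset.univ ×ˢ (G m ×ˢ G m)).filter fun p => ∀ j, p.2.1 j ≤ p.2.2 j + 1 ∧ p.2.2 j ≤ p.2.1 j + 1
  let A : ℕ → Fin d × (Fin N → ℕ) × (Fin N → ℕ) → Set Ω := fun m p =>
    {ω | c * (m * (√2)⁻¹ ^ m) ≤ W (dyadicPoint m p.2.1) ω p.1 - W (dyadicPoint m p.2.2) ω p.1}
  -- The rate at which the exponential moment of an increment is evaluated.
  let K : ℝ := (2 * N + 1) * Real.log 2 / c
  have hK : 0 ≤ K := by positivity
  have hA : ∀ m, ∀ p ∈ T m, (ℙ : Measure Ω).real (A m p) ≤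
      Real.exp (N * (M : ℝ) ^ N * K ^ 2) * (1 / 2) ^ ((2 * N + 1) * m) := by
    intro m p hp
    simp only [T, Finset.mem_filter, Finset.mem_product, Finset.mem_univ, true_and, hG] at hp
    obtain ⟨⟨hk, hl⟩, hkl⟩ := hp
    have h2 : (0 : ℝ) < 2 ^ m := by positivity
    have hbox : ∀ k : Fin N → ℕ, (∀ j, k j ≤ M * 2 ^ m) →
        ∀ j, 0 ≤ dyadicPoint m k j ∧ dyadicPoint m k j ≤ (M : ℝ) := by
      intro k hk j
      refine ⟨by unfold dyadicPoint; positivity, ?_⟩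
      rw [dyadicPoint, div_le_iff₀ h2]
      exact_mod_cast hk j
    have hsq : (√2)⁻¹ ^ m * √2 ^ m = (1 : ℝ) := by
      rw [← mul_pow, inv_mul_cancel₀ (by positivity), one_pow]
    have hsq2 : (√2 ^ m) ^ 2 = (2 : ℝ) ^ m := by
      rw [← pow_mul, mul_comm, pow_mul, Real.sq_sqrt zero_le_two]
    refine (hW.measureReal_le_sub_le p.1 (M := M) (by exact_mod_cast hM) (hbox _ hl) (hbox _ hk)
      (δ := (2 ^ m)⁻¹) (by positivity) (fun j => ?_) _ (a := K * √2 ^ m)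
      (by positivity)).trans_eq ?_
    · rw [dyadicPoint, dyadicPoint, ← sub_div, abs_div, abs_of_pos h2, div_eq_mul_inv]
      refine mul_le_of_le_one_left (by positivity) (abs_le.2 ?_)
      have h3 : (p.2.1 j : ℝ) ≤ p.2.2 j + 1 := by exact_mod_cast (hkl j).1
      have h4 : (p.2.2 j : ℝ) ≤ p.2.1 j + 1 := by exact_mod_cast (hkl j).2
      constructor <;> linarith
    · have e1 : -(K * √2 ^ m) * (c * (m * (√2)⁻¹ ^ m)) =
          ((2 * N + 1) * m : ℕ) * -Real.log 2 := by
        calc -(K * √2 ^ m) * (c * (m * (√2)⁻¹ ^ m))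
            = -(K * c) * m * ((√2)⁻¹ ^ m * √2 ^ m) := by ring
          _ = _ := by
              rw [hsq, div_mul_cancel₀ _ hc.ne']
              push_cast
              ring
      have e2 : N * (M : ℝ) ^ N * (2 ^ m)⁻¹ * (K * √2 ^ m) ^ 2 = N * (M : ℝ) ^ N * K ^ 2 := by
        rw [mul_pow, hsq2]
        field_simp
      rw [e1, e2, add_comm, Real.exp_add, Real.exp_nat_mul, Real.exp_neg,
        Real.exp_log two_pos, one_div]
  let C : ℝ := d * ((M + 1) ^ N) ^ 2 * Real.exp (N * (M : ℝ) ^ N * K ^ 2)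
  have hB : ∀ m, (ℙ : Measure Ω) (⋃ p ∈ T m, A m p) ≤ ENNReal.ofReal (C * (1 / 2) ^ m) := by
    intro m
    rw [← ofReal_measureReal (measure_ne_top _ _)]
    refine ENNReal.ofReal_le_ofReal ?_
    have hT : ((T m).card : ℝ) ≤ d * ((M + 1) ^ N * 2 ^ (N * m)) ^ 2 := by
      calc ((T m).card : ℝ) ≤ ((Finset.univ ×ˢ (G m ×ˢ G m) :
              Finset (Fin d × (Fin N → ℕ) × (Fin N → ℕ))).card : ℝ) := by
            exact_mod_cast Finset.card_filter_le _ _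
        _ = d * (G m).card ^ 2 := by
            rw [Finset.card_product, Finset.card_product, Finset.card_univ, Fintype.card_fin]
            push_cast
            ring
        _ ≤ _ := by gcongr; exact hGcard m
    calc (ℙ : Measure Ω).real (⋃ p ∈ T m, A m p)
        ≤ ∑ p ∈ T m, (ℙ : Measure Ω).real (A m p) := measureReal_biUnion_finset_le _ _
      _ ≤ ∑ _p ∈ T m, Real.exp (N * (M : ℝ) ^ N * K ^ 2) * (1 / 2) ^ ((2 * N + 1) * m) :=
          Finset.sum_le_sum (hA m)
      _ = (T m).card * (Real.exp (N * (M : ℝ) ^ N * K ^ 2) * (1 / 2) ^ ((2 * N + 1) * m)) := by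
          rw [Finset.sum_const, nsmul_eq_mul]
      _ ≤ d * ((M + 1) ^ N * 2 ^ (N * m)) ^ 2 *
            (Real.exp (N * (M : ℝ) ^ N * K ^ 2) * (1 / 2) ^ ((2 * N + 1) * m)) := by gcongr
      _ = C * (1 / 2) ^ m * ((2 * (1 / 2)) ^ (2 * N * m)) := by
          simp only [C]
          rw [mul_pow (2 : ℝ)]
          ring
      _ = C * (1 / 2) ^ m := by norm_num
  have hsum : ∑' m, (ℙ : Measure Ω) (⋃ p ∈ T m, A m p) ≠ ∞ := by
    have hS : Summable fun m : ℕ => C * (1 / 2 : ℝ) ^ m := summable_geometric_two.mul_left C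
    exact ne_top_of_le_ne_top hS.tsum_ofReal_ne_top (ENNReal.tsum_le_tsum hB)
  filter_upwards [ae_eventually_notMem hsum] with ω hω
  filter_upwards [hω] with m hm i k l hk hl hkl hlk
  by_contra! hlt
  refine hm (mem_iUnion₂.2 ⟨(i, k, l), ?_, hlt.le⟩)
  simp only [T, Finset.mem_filter, Finset.mem_product, Finset.mem_univ, true_and, hG]
  exact ⟨⟨hk, hl⟩, fun j => ⟨hkl j, hlk j⟩⟩

/-- Orey–Pruitt modulus of continuity: for an `(N,d)`-Brownian sheet,
on any compact box `[0,R]^N`, almost surely there is a random rank `n₀` such that for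
all `n ≥ n₀` and all `s, t` in the box with `‖t - s‖_∞ < 2^{-n}`,
`|W(t) - W(s)| ≤ n 2^{-n/2}`. -/
theorem orey_pruitt_modulus {Ω : Type} [MeasureSpace Ω]
    [IsProbabilityMeasure (ℙ : Measure Ω)]
    (N d : ℕ) (W : (Fin N → ℝ) → Ω → (Fin d → ℝ)) (hW : IsBrownianSheet N d W)
    (R : ℝ) (hR : 0 < R) :
    ∀ᵐ ω ∂(ℙ : Measure Ω), ∃ n₀ : ℕ, ∀ n : ℕ, n₀ ≤ n →
      ∀ s t : Fin N → ℝ, (∀ j, 0 ≤ s j ∧ s j ≤ R) → (∀ j, 0 ≤ t j ∧ t j ≤ R) →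
        (∀ j, |t j - s j| < (2 : ℝ) ^ (-(n : ℝ))) →
        Real.sqrt (∑ i, (W t ω i - W s ω i) ^ 2) ≤ n * (2 : ℝ) ^ (-(n : ℝ) / 2) := by
  obtain ⟨M, hRM⟩ := exists_nat_ge (max R 1)
  have hM : 1 ≤ M := by exact_mod_cast (le_max_right R 1).trans hRM
  have hR' : R ≤ M := (le_max_left R 1).trans hRM
  have hc : (0 : ℝ) < 1 / (17 * (d + 1)) := by positivity
  filter_upwards [hW.ae_eventually_dyadic_increments_le hM hc] with ω hω
  obtain ⟨n₁, hn₁⟩ := eventually_atTop.1 hω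
  refine ⟨max n₁ 10, fun n hn s t hs ht hst => ?_⟩
  have hpow : (2 : ℝ) ^ (-(n : ℝ) / 2) = (√2)⁻¹ ^ n := by
    rw [Real.sqrt_eq_rpow, ← Real.rpow_neg zero_le_two, ← Real.rpow_mul_natCast zero_le_two]
    congr 1
    ring
  have hcoord : ∀ i, |W t ω i - W s ω i| ≤ 1 / (d + 1) * (n * (√2)⁻¹ ^ n) := by
    intro i
    have h := abs_sub_le_of_dyadic_increments (f := fun u => W u ω i)
      ((continuous_apply i).comp (hW.1 ω)) hc.le ((le_max_right _ _).trans hn)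
      (fun m hm k l hk hl hkl hlk => by
        have hm' := hn₁ m (((le_max_left _ _).trans hn).trans hm) i
        have h1 := hm' k l hk hl hkl hlk
        have h2 := hm' l k hl hk hlk hkl
        exact abs_le.2 ⟨by linarith, h1⟩)
      (fun j => ⟨(hs j).1, (hs j).2.trans hR'⟩) (fun j => ⟨(ht j).1, (ht j).2.trans hR'⟩)
      (fun j => by
        have := hst j
        rwa [Real.rpow_neg zero_le_two, Real.rpow_natCast] at this)
    refine h.trans_eq ?_
    field_simp
  rw [hpow]
  have hb : 0 ≤ (n : ℝ) * (√2)⁻¹ ^ n := by positivity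
  refine Real.sqrt_le_iff.2 ⟨hb, ?_⟩
  calc ∑ i, (W t ω i - W s ω i) ^ 2
      ≤ ∑ _i : Fin d, (1 / (d + 1) * (n * (√2)⁻¹ ^ n)) ^ 2 :=
        Finset.sum_le_sum fun i _ => sq_le_sq' (abs_le.1 (hcoord i)).1 (abs_le.1 (hcoord i)).2
    _ = d / (d + 1) ^ 2 * (n * (√2)⁻¹ ^ n) ^ 2 := by
        rw [Finset.sum_const, Finset.card_univ, Fintype.card_fin, nsmul_eq_mul]
        field_simp
    _ ≤ (n * (√2)⁻¹ ^ n) ^ 2 := by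
        refine mul_le_of_le_one_left (sq_nonneg _) ((div_le_one (by positivity)).2 ?_)
        have : (0 : ℝ) ≤ d := by positivity
        nlinarith
end
end
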